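/- There exists N such that for all n ≥ N the following holds. For every real α with |α| ≤ 1/2, if A is a uniformly random n-sided die in the balanced sequences model, then with probability at least 1 − n^{−10} over A, for every real β one has |f̂(α,β)| ≤ 1 − δ, where δ = min(10^{−13}, 10^{−11}·α²·n/log n). -/

import Mathlib

open Finset

def dieFinset (n : ℕ) : Finset (Fin n → ℕ) :=
  (Fintype.piFinset fun _ : Fin n => Finset.Icc 1 n).filter
    fun A => ∑ i, A i = n * (n + 1) / 2

def beats {n : ℕ} (A B : Fin n → ℕ) : Prop :=
  ((Finset.univ : Finset (Fin n × Fin n)).filter fun p => B p.2 < A p.1).card >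
    ((Finset.univ : Finset (Fin n × Fin n)).filter fun p => A p.1 < B p.2).card

def ties {n : ℕ} (A B : Fin n → ℕ) : Prop :=
  ((Finset.univ : Finset (Fin n × Fin n)).filter fun p => B p.2 < A p.1).card =
    ((Finset.univ : Finset (Fin n × Fin n)).filter fun p => A p.1 < B p.2).card

instance {n : ℕ} (A B : Fin n → ℕ) : Decidable (beats A B) := by unfold beats; infer_instance
instance {n : ℕ} (A B : Fin n → ℕ) : Decidable (ties A B) := by unfold ties; infer_instance

noncomputable def fA {n : ℕ} (A : Fin n → ℕ) (j : ℕ) : ℝ :=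
  ((Finset.univ.filter fun i => A i < j).card : ℝ) +
    (1 / 2) * ((Finset.univ.filter fun i => A i = j).card : ℝ)

noncomputable def gA {n : ℕ} (A : Fin n → ℕ) (j : ℕ) : ℝ := fA A j - j + 1 / 2

noncomputable def e (x : ℝ) : ℂ := Complex.exp (2 * Real.pi * Complex.I * x)

noncomputable def fhat (n : ℕ) (A : Fin n → ℕ) (α β : ℝ) : ℂ :=
  (n : ℂ)⁻¹ * ∑ j ∈ Finset.Icc 1 n, e (α * gA A j + β * ((j : ℝ) - (n + 1) / 2))

lemma die_card (n : ℕ) (hn : 2 ≤ n) : n ^ n ≤ (dieFinset n).card * n ^ 3 := by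
  set m := n / 2 with hm
  set P : Finset (Fin m → ℕ) := Fintype.piFinset fun _ : Fin m => Finset.Icc 1 n with hP
  have hPc : P.card = n ^ m := by simp [hP, Fintype.card_piFinset]
  set N : ℕ → ℕ := fun s => (P.filter fun x => ∑ i, x i = s).card with hN
  have hsum : ∑ s ∈ Finset.range (m * n + 1), N s = P.card := by
    rw [hN]
    refine (Finset.card_eq_sum_card_fiberwise ?_).symm
    intro x hx
    have hx' : ∀ i, x i ∈ Finset.Icc 1 n := Fintype.mem_piFinset.1 hx
    have : ∑ i, x i ≤ ∑ _i : Fin m, n := Finset.sum_le_sum fun i _ => (Finset.mem_Icc.1 (hx' i)).2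
    simp at this
    simp; omega
  have hcs : P.card ^ 2 ≤ (m * n + 1) * ∑ s ∈ Finset.range (m * n + 1), N s ^ 2 := by
    rw [← hsum]
    simpa using sq_sum_le_card_mul_sum_sq (s := Finset.range (m * n + 1)) (f := N)
  set Q := (P ×ˢ P).filter fun p => ∑ i, p.1 i = ∑ i, p.2 i with hQ
  have hQc : ∑ s ∈ Finset.range (m * n + 1), N s ^ 2 ≤ Q.card := by
    have : ∀ s ∈ Finset.range (m * n + 1), N s ^ 2 ≤ (Q.filter fun p => ∑ i, p.1 i = s).card := by
      intro s _
      rw [hN, sq, ← Finset.card_product]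
      refine Finset.card_le_card ?_
      intro p hp
      simp only [Finset.mem_product, Finset.mem_filter, hQ] at hp ⊢
      obtain ⟨⟨h1, h2⟩, h3, h4⟩ := hp
      exact ⟨⟨⟨h1, h3⟩, h2.trans h4.symm⟩, h2⟩
    refine (Finset.sum_le_sum this).trans ?_
    refine (Finset.card_eq_sum_card_fiberwise ?_).ge
    intro p hp
    have hx' : ∀ i, p.1 i ∈ Finset.Icc 1 n := Fintype.mem_piFinset.1
      (Finset.mem_product.1 (Finset.mem_filter.1 hp).1).1
    have : ∑ i, p.1 i ≤ ∑ _i : Fin m, n := Finset.sum_le_sum fun i _ => (Finset.mem_Icc.1 (hx' i)).2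
    simp at this
    simp; omega
  have hQD : Q.card ≤ (dieFinset n).card := by
    have hcard : Fintype.card (Fin n) = Fintype.card (Fin m ⊕ Fin m ⊕ Fin (n % 2)) := by
      simp; omega
    let eq := Fintype.equivOfCardEq hcard
    let F : (Fin m → ℕ) × (Fin m → ℕ) → (Fin n → ℕ) := fun p i =>
      Sum.elim p.1 (Sum.elim (fun i => n + 1 - p.2 i) (fun _ => (n + 1) / 2)) (eq i)
    refine Finset.card_le_card_of_injOn F ?_ ?_
    · intro p hp
      simp only [hQ, hP, Finset.coe_filter, Finset.mem_product, Fintype.mem_piFinset, Finset.mem_Icc,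
        Set.mem_ofPred_eq] at hp
      obtain ⟨⟨h1, h2⟩, h3⟩ := hp
      simp only [dieFinset, Finset.coe_filter, Fintype.mem_piFinset, Finset.mem_Icc, Set.mem_ofPred_eq]
      constructor
      · intro i
        simp only [F]
        rcases eq i with a | a | a
        · exact h1 a
        · have := h2 a; simp only [Sum.elim_inr, Sum.elim_inl]; omega
        · simp only [Sum.elim_inr]; omega
      · have : ∑ i, F p i = ∑ x : Fin m ⊕ Fin m ⊕ Fin (n % 2), Sum.elim p.1 (Sum.elim (fun i => n + 1 - p.2 i) (fun _ => (n + 1) / 2)) x :=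
          Equiv.sum_comp eq (fun x => Sum.elim p.1 (Sum.elim (fun i => n + 1 - p.2 i) (fun _ => (n + 1) / 2)) x)
        rw [this]
        simp only [Fintype.sum_sum_type, Sum.elim_inl, Sum.elim_inr, h3]
        rw [← add_assoc, ← Finset.sum_add_distrib]
        have h4 : ∀ i : Fin m, p.2 i + (n + 1 - p.2 i) = n + 1 := fun i => by have := h2 i; omega
        simp only [h4, Finset.sum_const, Finset.card_univ, Fintype.card_fin, smul_eq_mul]
        rcases Nat.even_or_odd' n with ⟨c, hc | hc⟩
        · have h5 : n % 2 = 0 := by omega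
          have h6 : m = c := by omega
          rw [h5, h6, hc]
          have : 2 * c * (2 * c + 1) / 2 = c * (2 * c + 1) := by
            rw [mul_assoc, Nat.mul_div_cancel_left _ (by norm_num)]
          rw [this]; ring
        · have h5 : n % 2 = 1 := by omega
          have h6 : m = c := by omega
          rw [h5, h6, hc]
          have h7 : (2 * c + 1) * (2 * c + 1 + 1) / 2 = (2 * c + 1) * (c + 1) := by
            rw [show (2 * c + 1) * (2 * c + 1 + 1) = 2 * ((2 * c + 1) * (c + 1)) by ring,
              Nat.mul_div_cancel_left _ (by norm_num)]
          have h8 : (2 * c + 1 + 1) / 2 = c + 1 := by omega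
          rw [h7, h8]; ring
    · intro p hp q hq h
      simp only [hQ, hP, Finset.coe_filter, Finset.mem_product, Fintype.mem_piFinset, Finset.mem_Icc,
        Set.mem_ofPred_eq] at hp hq
      have hx : ∀ x : Fin m ⊕ Fin m ⊕ Fin (n % 2), Sum.elim p.1 (Sum.elim (fun i => n + 1 - p.2 i) (fun _ => (n + 1) / 2)) x
          = Sum.elim q.1 (Sum.elim (fun i => n + 1 - q.2 i) (fun _ => (n + 1) / 2)) x := by
        intro x
        have := congrFun h (eq.symm x)
        simpa [F] using this
      refine Prod.ext (funext fun i => ?_) (funext fun i => ?_)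
      · simpa using hx (Sum.inl i)
      · have h1 := hx (Sum.inr (Sum.inl i))
        simp only [Sum.elim_inr, Sum.elim_inl] at h1
        have h2 := hp.1.2 i
        have h3 := hq.1.2 i
        omega
  have hmn : m * n + 1 ≤ n ^ 2 := by
    have : 2 * m ≤ n := by omega
    nlinarith
  have h1 : n ^ n ≤ n ^ (2 * m + 1) := Nat.pow_le_pow_right (by omega) (by omega)
  calc n ^ n ≤ n ^ (2 * m + 1) := h1
    _ = P.card ^ 2 * n := by rw [hPc]; ring
    _ ≤ ((m * n + 1) * (dieFinset n).card) * n := by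
        gcongr
        exact hcs.trans (Nat.mul_le_mul_left _ (hQc.trans hQD))
    _ ≤ (n ^ 2 * (dieFinset n).card) * n := by gcongr
    _ = _ := by ring

lemma e_eq (x : ℝ) : e x = Complex.exp (((2 * Real.pi * x : ℝ) : ℂ) * Complex.I) := by
  unfold e; congr 1; push_cast; ring

lemma e_add (x y : ℝ) : e (x + y) = e x * e y := by
  unfold e; rw [← Complex.exp_add]; congr 1; push_cast; ring

lemma e_zero : e 0 = 1 := by simp [e]

lemma e_sum {ι : Type*} (s : Finset ι) (f : ι → ℝ) : e (∑ i ∈ s, f i) = ∏ i ∈ s, e (f i) := by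
  classical
  induction s using Finset.induction_on with
  | empty => simp [e_zero]
  | insert a s ha ih => rw [Finset.sum_insert ha, Finset.prod_insert ha, e_add, ih]

lemma e_cos_sin (x : ℝ) : e x = (Real.cos (2 * Real.pi * x) : ℂ)
    + (Real.sin (2 * Real.pi * x) : ℂ) * Complex.I := by
  rw [e_eq, Complex.exp_mul_I]; push_cast; rfl

lemma e_re (x : ℝ) : (e x).re = Real.cos (2 * Real.pi * x) := by
  rw [e_eq, Complex.exp_ofReal_mul_I_re]

lemma cos_eq_e (x : ℝ) : ((Real.cos (2 * Real.pi * x) : ℝ) : ℂ) = (e x + e (-x)) / 2 := by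
  rw [e_cos_sin, e_cos_sin]
  rw [show 2 * Real.pi * -x = -(2 * Real.pi * x) by ring, Real.cos_neg, Real.sin_neg]
  push_cast; ring

/-- the coefficient and sign tables of the expansion -/
noncomputable def cf : Fin 3 → ℝ := ![3/4, 1/8, 1/8]
noncomputable def sg : Fin 3 → ℝ := ![0, 1, -1]
noncomputable def asg : Fin 3 → ℝ := ![0, 1, 1]

lemma mgf_identity (n M : ℕ) (w : Fin M → ℕ → ℝ) (α : ℝ) (c : Fin M → ℝ)
    (hdis : ∀ v b b', w b v ≠ 0 → w b' v ≠ 0 → b = b')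
    (hp : ∀ b, ∑ v ∈ Finset.Icc 1 n, (e (α * w b v) - 1) = -(c b : ℂ))
    (hm : ∀ b, ∑ v ∈ Finset.Icc 1 n, (e (-(α * w b v)) - 1) = -(c b : ℂ)) :
    ∑ A ∈ (Fintype.piFinset fun _ : Fin n => Finset.Icc 1 n),
      ∏ b, (3/4 + 1/4 * Real.cos (2 * Real.pi * (α * ∑ i, w b (A i)))) =
    ∑ ε : Fin M → Fin 3, (∏ b, cf (ε b)) * ((n : ℝ) - ∑ b, asg (ε b) * c b) ^ n := by
  have key : ∀ ε : Fin M → Fin 3,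
      ∑ v ∈ Finset.Icc 1 n, e (∑ b, sg (ε b) * (α * w b v)) =
        (((n : ℝ) - ∑ b, asg (ε b) * c b : ℝ) : ℂ) := by
    intro ε
    have h1 : ∀ v, e (∑ b, sg (ε b) * (α * w b v)) =
        1 + ∑ b, (e (sg (ε b) * (α * w b v)) - 1) := by
      intro v
      by_cases h : ∃ b, w b v ≠ 0
      · obtain ⟨b, hb⟩ := h
        have h0 : ∀ b', b' ≠ b → w b' v = 0 := by
          intro b' hb'
          by_contra h
          exact hb' (hdis v b' b h hb)
        rw [Finset.sum_eq_single b, Finset.sum_eq_single b]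
        · ring
        · intro b' _ hb'; rw [h0 b' hb']; simp [e_zero]
        · simp
        · intro b' _ hb'; rw [h0 b' hb']; simp
        · simp
      · push Not at h
        simp [h, e_zero]
    simp_rw [h1]
    rw [Finset.sum_add_distrib, Finset.sum_comm]
    have h2 : ∀ b, ∑ v ∈ Finset.Icc 1 n, (e (sg (ε b) * (α * w b v)) - 1)
        = -((asg (ε b) * c b : ℝ) : ℂ) := by
      intro b
      generalize ε b = t
      fin_cases t
      · simp [sg, asg, e_zero]
      · simpa [sg, asg] using hp b
      · simpa [sg, asg] using hm b
    simp_rw [h2]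
    simp
    ring
  have hA : ∀ A : Fin n → ℕ, ((∏ b, (3/4 + 1/4 * Real.cos (2 * Real.pi * (α * ∑ i, w b (A i)))) : ℝ) : ℂ)
      = ∑ ε : Fin M → Fin 3, ((∏ b, cf (ε b) : ℝ) : ℂ) *
          ∏ i, e (∑ b, sg (ε b) * (α * w b (A i))) := by
    intro A
    have h3 : ∀ b, ((3/4 + 1/4 * Real.cos (2 * Real.pi * (α * ∑ i, w b (A i))) : ℝ) : ℂ)
        = ∑ t : Fin 3, (cf t : ℂ) * e (sg t * (α * ∑ i, w b (A i))) := by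
      intro b
      rw [Complex.ofReal_add, Complex.ofReal_mul, cos_eq_e, Fin.sum_univ_three]
      simp [cf, sg, e_zero]
      ring
    rw [Complex.ofReal_prod]
    simp_rw [h3]
    rw [Finset.prod_univ_sum, Fintype.piFinset_univ]
    refine Finset.sum_congr rfl fun ε _ => ?_
    rw [Finset.prod_mul_distrib, Complex.ofReal_prod]
    congr 1
    rw [← e_sum, ← e_sum, Finset.sum_comm]
    congr 1
    refine Finset.sum_congr rfl fun b _ => ?_
    rw [Finset.mul_sum, Finset.mul_sum]
  apply Complex.ofReal_injective
  rw [Complex.ofReal_sum]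
  simp_rw [hA]
  rw [Finset.sum_comm, Complex.ofReal_sum]
  refine Finset.sum_congr rfl fun ε _ => ?_
  rw [← Finset.mul_sum, Complex.ofReal_mul, Complex.ofReal_pow, ← key ε]
  congr 1
  rw [← Finset.prod_univ_sum (fun _ : Fin n => Finset.Icc 1 n)
    (fun _ v => e (∑ b, sg (ε b) * (α * w b v)))]
  simp

lemma mgf_bound (n M : ℕ) (hn : 1 ≤ n) (w : Fin M → ℕ → ℝ) (α : ℝ) (c : Fin M → ℝ)
    (hdis : ∀ v b b', w b v ≠ 0 → w b' v ≠ 0 → b = b')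
    (hp : ∀ b, ∑ v ∈ Finset.Icc 1 n, (e (α * w b v) - 1) = -(c b : ℂ))
    (hm : ∀ b, ∑ v ∈ Finset.Icc 1 n, (e (-(α * w b v)) - 1) = -(c b : ℂ))
    (hc1 : ∀ b, 1 ≤ c b) (hcn : ∑ b, c b ≤ n) :
    ∑ A ∈ (Fintype.piFinset fun _ : Fin n => Finset.Icc 1 n),
      ∏ b, (3/4 + 1/4 * Real.cos (2 * Real.pi * (α * ∑ i, w b (A i)))) ≤
    (n : ℝ) ^ n * Real.exp (-(M / 8)) := by
  rw [mgf_identity n M w α c hdis hp hm]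
  have hn0 : (0 : ℝ) < n := by exact_mod_cast hn
  have hcf : ∀ t, 0 ≤ cf t := by intro t; fin_cases t <;> norm_num [cf]
  have hasg : ∀ t, 0 ≤ asg t := by intro t; fin_cases t <;> simp [asg]
  have hasg1 : ∀ t, asg t ≤ 1 := by intro t; fin_cases t <;> simp [asg]
  have h1 : ∀ ε : Fin M → Fin 3, ((n : ℝ) - ∑ b, asg (ε b) * c b) ^ n ≤
      (n : ℝ) ^ n * ∏ b, Real.exp (-asg (ε b)) := by
    intro ε
    set T := ∑ b, asg (ε b) * c b with hT
    have hT1 : T ≤ n := by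
      refine le_trans (Finset.sum_le_sum fun b _ => ?_) hcn
      nlinarith [hasg1 (ε b), hc1 b]
    have hT2 : ∑ b, asg (ε b) ≤ T := by
      refine Finset.sum_le_sum fun b _ => ?_
      nlinarith [hasg (ε b), hc1 b]
    have h2 : (n : ℝ) - T ≤ n * Real.exp (-(T / n)) := by
      have := Real.add_one_le_exp (-(T / n))
      calc (n : ℝ) - T = n * (-(T / n) + 1) := by field_simp; ring
        _ ≤ _ := by gcongr
    calc ((n : ℝ) - T) ^ n ≤ (n * Real.exp (-(T / n))) ^ n := by
          apply pow_le_pow_left₀ (by linarith) h2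
      _ = (n : ℝ) ^ n * Real.exp (-T) := by
          rw [mul_pow, ← Real.exp_nat_mul]; congr 2; field_simp
      _ ≤ (n : ℝ) ^ n * Real.exp (∑ b, -asg (ε b)) := by
          gcongr; rw [Finset.sum_neg_distrib]; linarith
      _ = _ := by rw [Real.exp_sum]
  have h3 : ∑ t : Fin 3, cf t * Real.exp (-asg t) ≤ Real.exp (-(1/8)) := by
    have h4 : Real.exp (-1) ≤ 1/2 := by
      rw [Real.exp_neg, inv_le_comm₀ (Real.exp_pos _) (by norm_num)]
      have := Real.add_one_le_exp (1 : ℝ)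
      norm_num at this ⊢; linarith
    have h5 := Real.add_one_le_exp (-(1/8) : ℝ)
    simp [Fin.sum_univ_three, cf, asg]
    norm_num at h5
    linarith
  calc ∑ ε : Fin M → Fin 3, (∏ b, cf (ε b)) * ((n : ℝ) - ∑ b, asg (ε b) * c b) ^ n
      ≤ ∑ ε : Fin M → Fin 3, (∏ b, cf (ε b)) * ((n : ℝ) ^ n * ∏ b, Real.exp (-asg (ε b))) := by
        refine Finset.sum_le_sum fun ε _ => mul_le_mul_of_nonneg_left (h1 ε) ?_
        exact Finset.prod_nonneg fun b _ => hcf _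
    _ = (n : ℝ) ^ n * ∑ ε : Fin M → Fin 3, ∏ b, (cf (ε b) * Real.exp (-asg (ε b))) := by
        rw [Finset.mul_sum]
        refine Finset.sum_congr rfl fun ε _ => ?_
        rw [Finset.prod_mul_distrib]; ring
    _ = (n : ℝ) ^ n * (∑ t : Fin 3, cf t * Real.exp (-asg t)) ^ M := by
        congr 1
        have := Finset.prod_univ_sum (fun _ : Fin M => (Finset.univ : Finset (Fin 3)))
          (fun _ t => cf t * Real.exp (-asg t))
        rw [Fintype.piFinset_univ] at this
        rw [← this]; simp
    _ ≤ (n : ℝ) ^ n * (Real.exp (-(1/8))) ^ M := by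
        gcongr
        exact Finset.sum_nonneg fun t _ => mul_nonneg (hcf t) (Real.exp_pos _).le
    _ = _ := by rw [← Real.exp_nat_mul]; congr 2; ring

noncomputable def uu (j v : ℕ) : ℝ := (if v < j then 1 else 0) + 1 / 2 * (if v = j then 1 else 0)

noncomputable def ww (k j v : ℕ) : ℝ := uu (j + 2 * k) v - 2 * uu (j + k) v + uu j v

lemma fA_eq {n : ℕ} (A : Fin n → ℕ) (j : ℕ) : fA A j = ∑ i, uu j (A i) := by
  unfold fA uu
  rw [Finset.sum_add_distrib, ← Finset.mul_sum]
  simp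

lemma gA_second {n : ℕ} (A : Fin n → ℕ) (k j : ℕ) :
    gA A (j + 2 * k) - 2 * gA A (j + k) + gA A j = ∑ i, ww k j (A i) := by
  unfold gA ww
  simp only [fA_eq, Finset.sum_add_distrib, Finset.sum_sub_distrib, ← Finset.mul_sum]
  push_cast; ring

lemma ww_zero (k j v : ℕ) (h : v ∉ (Finset.Icc j (j + 2 * k)).erase (j + k)) : ww k j v = 0 := by
  simp only [Finset.mem_erase, Finset.mem_Icc, not_and_or, not_not, not_le] at h
  unfold ww uu
  split_ifs <;> first | omega | norm_num

lemma ww_sq (k j v : ℕ) (h : v ∈ (Finset.Icc j (j + 2 * k)).erase (j + k)) :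
    1 / 4 ≤ ww k j v ^ 2 := by
  simp only [Finset.mem_erase, Finset.mem_Icc] at h
  unfold ww uu
  split_ifs <;> first | omega | norm_num

lemma ww_abs (k j v : ℕ) : |ww k j v| ≤ 1 := by
  unfold ww uu
  split_ifs <;> first | omega | norm_num

lemma uu_refl (N j v : ℕ) (hj : j ≤ N) (hv : v ≤ N) : uu (N - j) (N - v) = 1 - uu j v := by
  unfold uu
  split_ifs <;> first | omega | norm_num

lemma ww_anti (k j v : ℕ) (h : v ∈ Finset.Icc j (j + 2 * k)) :
    ww k j (2 * j + 2 * k - v) = - ww k j v := by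
  simp only [Finset.mem_Icc] at h
  have h1 := uu_refl (2 * j + 2 * k) j v (by omega) (by omega)
  have h2 := uu_refl (2 * j + 2 * k) (j + k) v (by omega) (by omega)
  have h3 := uu_refl (2 * j + 2 * k) (j + 2 * k) v (by omega) (by omega)
  rw [show 2 * j + 2 * k - j = j + 2 * k by omega] at h1
  rw [show 2 * j + 2 * k - (j + k) = j + k by omega] at h2
  rw [show 2 * j + 2 * k - (j + 2 * k) = j by omega] at h3
  unfold ww
  rw [h1, h2, h3]; ring

lemma sum_sin_ww (n k j : ℕ) (hj : 1 ≤ j) (hjn : j + 2 * k ≤ n) (α : ℝ) :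
    ∑ v ∈ Finset.Icc 1 n, Real.sin (2 * Real.pi * (α * ww k j v)) = 0 := by
  have hsub : Finset.Icc j (j + 2 * k) ⊆ Finset.Icc 1 n := Finset.Icc_subset_Icc hj hjn
  rw [← Finset.sum_subset hsub]
  · have h : ∑ v ∈ Finset.Icc j (j + 2 * k), Real.sin (2 * Real.pi * (α * ww k j v)) =
        ∑ v ∈ Finset.Icc j (j + 2 * k), - Real.sin (2 * Real.pi * (α * ww k j v)) := by
      refine Finset.sum_bij' (fun v _ => 2 * j + 2 * k - v) (fun v _ => 2 * j + 2 * k - v) ?_ ?_ ?_ ?_ ?_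
      · intro a ha; simp only [Finset.mem_Icc] at ha ⊢; omega
      · intro a ha; simp only [Finset.mem_Icc] at ha ⊢; omega
      · intro a ha; simp only [Finset.mem_Icc] at ha; omega
      · intro a ha; simp only [Finset.mem_Icc] at ha; omega
      · intro a ha
        rw [ww_anti k j a ha]
        rw [← Real.sin_neg]; congr 1; ring
    rw [Finset.sum_neg_distrib] at h
    linarith
  · intro v _ hv
    rw [ww_zero k j v (fun h => hv (Finset.mem_of_mem_erase h))]; simp

noncomputable def cc (n k j : ℕ) (α : ℝ) : ℝ :=
  ∑ v ∈ Finset.Icc 1 n, (1 - Real.cos (2 * Real.pi * (α * ww k j v)))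

lemma sum_e_ww (n k j : ℕ) (hj : 1 ≤ j) (hjn : j + 2 * k ≤ n) (α : ℝ) :
    ∑ v ∈ Finset.Icc 1 n, (e (α * ww k j v) - 1) = -(cc n k j α : ℂ) := by
  have h := sum_sin_ww n k j hj hjn α
  have h2 : ∀ v, e (α * ww k j v) - 1 = -((1 - Real.cos (2 * Real.pi * (α * ww k j v)) : ℝ) : ℂ)
      + ((Real.sin (2 * Real.pi * (α * ww k j v)) : ℝ) : ℂ) * Complex.I := by
    intro v; rw [e_cos_sin]; push_cast; ring
  simp_rw [h2]
  rw [Finset.sum_add_distrib, ← Finset.sum_mul, ← Complex.ofReal_sum, h, Finset.sum_neg_distrib,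
    ← Complex.ofReal_sum]
  simp [cc]

lemma sum_e_ww_neg (n k j : ℕ) (hj : 1 ≤ j) (hjn : j + 2 * k ≤ n) (α : ℝ) :
    ∑ v ∈ Finset.Icc 1 n, (e (-(α * ww k j v)) - 1) = -(cc n k j α : ℂ) := by
  have h := sum_e_ww n k j hj hjn (-α)
  have h2 : cc n k j (-α) = cc n k j α := by
    unfold cc
    refine Finset.sum_congr rfl fun v _ => ?_
    rw [← Real.cos_neg]; congr 2; ring
  rw [h2] at h
  rw [← h]
  refine Finset.sum_congr rfl fun v _ => ?_
  congr 2; ring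

lemma cc_eq (n k j : ℕ) (hj : 1 ≤ j) (hjn : j + 2 * k ≤ n) (α : ℝ) :
    cc n k j α = ∑ v ∈ (Finset.Icc j (j + 2 * k)).erase (j + k),
      (1 - Real.cos (2 * Real.pi * (α * ww k j v))) := by
  symm
  refine Finset.sum_subset ((Finset.erase_subset _ _).trans (Finset.Icc_subset_Icc hj hjn)) ?_
  intro v _ hv
  rw [ww_zero k j v hv]; simp

lemma card_T (k j : ℕ) : ((Finset.Icc j (j + 2 * k)).erase (j + k)).card = 2 * k := by
  rw [Finset.card_erase_of_mem (by simp; omega)]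
  simp; omega

lemma cc_le (n k j : ℕ) (hj : 1 ≤ j) (hjn : j + 2 * k ≤ n) (α : ℝ) : cc n k j α ≤ 4 * k := by
  rw [cc_eq n k j hj hjn]
  refine (Finset.sum_le_card_nsmul _ _ 2 ?_).trans ?_
  · intro v _; linarith [Real.neg_one_le_cos (2 * Real.pi * (α * ww k j v))]
  · rw [card_T]; simp; linarith

lemma le_cc (n k j : ℕ) (hj : 1 ≤ j) (hjn : j + 2 * k ≤ n) (α : ℝ) (hα : |α| ≤ 1 / 2)
    (hk : 1 / 4 ≤ α ^ 2 * k) : 1 ≤ cc n k j α := by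
  rw [cc_eq n k j hj hjn]
  refine le_trans ?_ (Finset.card_nsmul_le_sum _ _ (2 * α ^ 2) ?_)
  · rw [card_T]; simp; nlinarith
  · intro v hv
    have h1 := ww_sq k j v hv
    have h2 := ww_abs k j v
    have h3 : |2 * Real.pi * (α * ww k j v)| ≤ Real.pi := by
      rw [abs_mul, abs_mul, abs_mul, abs_of_pos Real.pi_pos, abs_two]
      have : |α| * |ww k j v| ≤ 1 / 2 * 1 := mul_le_mul hα h2 (abs_nonneg _) (by norm_num)
      nlinarith [Real.pi_pos]
    have h4 := Real.cos_le_one_sub_mul_cos_sq h3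
    have h5 : 2 / Real.pi ^ 2 * (2 * Real.pi * (α * ww k j v)) ^ 2 = 8 * α ^ 2 * ww k j v ^ 2 := by
      field_simp; ring
    rw [h5] at h4
    nlinarith [sq_nonneg α]

lemma one_sub_ge (x : ℝ) (h0 : 0 ≤ x) (h1 : x ≤ 1 / 2) : Real.exp (-(2 * x)) ≤ 1 - x := by
  rw [Real.exp_neg, inv_le_iff_one_le_mul₀ (Real.exp_pos _)]
  have := Real.add_one_le_exp (2 * x)
  nlinarith

/-- index of block `b` with offset `r` -/
def jj (k r b : ℕ) : ℕ := r + 1 + 6 * k * b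

noncomputable def YY {n : ℕ} (A : Fin n → ℕ) (α : ℝ) (k j : ℕ) : ℝ :=
  1 - Real.cos (2 * Real.pi * (α * ∑ i, ww k j (A i)))

lemma jj_bound (n k M r b : ℕ) (hr : r < k) (hb : b < M) (hM : 6 * k * M ≤ n) :
    jj k r b + 2 * k ≤ n := by
  unfold jj
  have : 6 * k * (b + 1) ≤ 6 * k * M := Nat.mul_le_mul_left _ hb
  nlinarith

lemma jj_sep (k r b b' : ℕ) (h : b < b') : jj k r b + 6 * k ≤ jj k r b' := by
  unfold jj
  have : 6 * k * (b + 1) ≤ 6 * k * b' := Nat.mul_le_mul_left _ h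
  nlinarith

lemma bad_count (n k M r : ℕ) (hr : r < k) (hM : 6 * k * M ≤ n) (hn : 1 ≤ n) (α : ℝ)
    (hα : |α| ≤ 1 / 2) (hk : 1 / 4 ≤ α ^ 2 * k) :
    (((Fintype.piFinset fun _ : Fin n => Finset.Icc 1 n).filter
      fun A => ∑ b : Fin M, YY A α k (jj k r b) < M / 8).card : ℝ) ≤
      (n : ℝ) ^ n * Real.exp (-(M / 16)) := by
  have hb : ∀ b : Fin M, jj k r b + 2 * k ≤ n := fun b => jj_bound n k M r b hr b.2 hM
  have hj1 : ∀ b : Fin M, 1 ≤ jj k r b := fun b => by unfold jj; omega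
  have hmain := mgf_bound n M hn (fun b => ww k (jj k r b)) α (fun b => cc n k (jj k r b) α) ?_
    (fun b => sum_e_ww n k _ (hj1 b) (hb b) α) (fun b => sum_e_ww_neg n k _ (hj1 b) (hb b) α)
    (fun b => le_cc n k _ (hj1 b) (hb b) α hα hk) ?_
  · set Ω := (Fintype.piFinset fun _ : Fin n => Finset.Icc 1 n) with hΩ
    set B := Ω.filter fun A => ∑ b : Fin M, YY A α k (jj k r b) < M / 8 with hB
    have hY0 : ∀ (A : Fin n → ℕ) j, 0 ≤ YY A α k j := fun A j => by
      unfold YY; linarith [Real.cos_le_one (2 * Real.pi * (α * ∑ i, ww k j (A i)))]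
    have hY2 : ∀ (A : Fin n → ℕ) j, YY A α k j ≤ 2 := fun A j => by
      unfold YY; linarith [Real.neg_one_le_cos (2 * Real.pi * (α * ∑ i, ww k j (A i)))]
    have hterm : ∀ A : Fin n → ℕ, Real.exp (-(∑ b : Fin M, YY A α k (jj k r b)) / 2) ≤
        ∏ b : Fin M, (3/4 + 1/4 * Real.cos (2 * Real.pi * (α * ∑ i, ww k (jj k r b) (A i)))) := by
      intro A
      rw [neg_div, Finset.sum_div, ← Finset.sum_neg_distrib, Real.exp_sum]
      refine Finset.prod_le_prod (fun _ _ => (Real.exp_pos _).le) fun b _ => ?_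
      have := one_sub_ge (YY A α k (jj k r b) / 4) (by linarith [hY0 A (jj k r b)])
        (by linarith [hY2 A (jj k r b)])
      have h2 : -(2 * (YY A α k (jj k r b) / 4)) = -(YY A α k (jj k r b) / 2) := by ring
      rw [h2] at this
      refine this.trans (le_of_eq ?_)
      unfold YY; ring
    have h1 : (B.card : ℝ) * Real.exp (-(M / 16)) ≤ (n : ℝ) ^ n * Real.exp (-(M / 8)) := by
      refine le_trans ?_ hmain
      calc (B.card : ℝ) * Real.exp (-(M / 16)) = ∑ A ∈ B, Real.exp (-(M / 16)) := by simp
        _ ≤ ∑ A ∈ B, ∏ b : Fin M, (3/4 + 1/4 * Real.cos (2 * Real.pi * (α * ∑ i, ww k (jj k r b) (A i)))) := by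
            refine Finset.sum_le_sum fun A hA => le_trans (Real.exp_le_exp.2 ?_) (hterm A)
            have := (Finset.mem_filter.1 hA).2
            linarith
        _ ≤ _ := by
            refine Finset.sum_le_sum_of_subset_of_nonneg (Finset.filter_subset _ _) fun A _ _ => ?_
            exact le_trans (Real.exp_pos _).le (hterm A)
    have h2 : Real.exp (-((M : ℝ) / 8)) = Real.exp (-(M / 16)) * Real.exp (-(M / 16)) := by
      rw [← Real.exp_add]; congr 1; ring
    rw [h2, ← mul_assoc] at h1
    exact le_of_mul_le_mul_right h1 (Real.exp_pos _)
  · intro v b b' h h'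
    have h1 : v ∈ Finset.Icc (jj k r b) (jj k r b + 2 * k) := by
      by_contra hc
      exact h (ww_zero _ _ _ fun hh => hc (Finset.mem_of_mem_erase hh))
    have h2 : v ∈ Finset.Icc (jj k r b') (jj k r b' + 2 * k) := by
      by_contra hc
      exact h' (ww_zero _ _ _ fun hh => hc (Finset.mem_of_mem_erase hh))
    rw [Finset.mem_Icc] at h1 h2
    rcases lt_trichotomy (b : ℕ) b' with hlt | heq | hgt
    · have := jj_sep k r _ _ hlt; omega
    · exact Fin.ext heq
    · have := jj_sep k r _ _ hgt; omega
  · refine (Finset.sum_le_sum fun b _ => cc_le n k _ (hj1 b) (hb b) α).trans ?_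
    simp
    have : ((6 * k * M : ℕ) : ℝ) ≤ n := by exact_mod_cast hM
    push_cast at this
    nlinarith [mul_nonneg (Nat.cast_nonneg (α := ℝ) k) (Nat.cast_nonneg (α := ℝ) M)]

noncomputable def ph (n : ℕ) (A : Fin n → ℕ) (α β : ℝ) (j : ℕ) : ℝ :=
  α * gA A j + β * ((j : ℝ) - (n + 1) / 2)

lemma fhat_rot (n : ℕ) (hn : 1 ≤ n) (A : Fin n → ℕ) (α β θ : ℝ) :
    n * (fhat n A α β * Complex.exp (((-θ : ℝ) : ℂ) * Complex.I)).re =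
      ∑ j ∈ Finset.Icc 1 n, Real.cos (2 * Real.pi * ph n A α β j - θ) := by
  have hn0 : (n : ℂ) ≠ 0 := by exact_mod_cast (by omega : n ≠ 0)
  have h : ((n : ℝ) : ℂ) * (fhat n A α β * Complex.exp (((-θ : ℝ) : ℂ) * Complex.I)) =
      ∑ j ∈ Finset.Icc 1 n,
        Complex.exp (((2 * Real.pi * ph n A α β j - θ : ℝ) : ℂ) * Complex.I) := by
    unfold fhat
    rw [← mul_assoc, ← mul_assoc, Complex.ofReal_natCast, mul_inv_cancel₀ hn0, one_mul, Finset.sum_mul]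
    refine Finset.sum_congr rfl fun j _ => ?_
    rw [e_eq, ← Complex.exp_add]
    congr 1
    unfold ph
    push_cast; ring
  rw [← Complex.re_ofReal_mul, h, Complex.re_sum]
  refine Finset.sum_congr rfl fun j _ => ?_
  rw [Complex.exp_ofReal_mul_I_re]

lemma fhat_exists (n : ℕ) (hn : 1 ≤ n) (A : Fin n → ℕ) (α β : ℝ) :
    ∃ θ : ℝ, n * (1 - ‖fhat n A α β‖) =
      ∑ j ∈ Finset.Icc 1 n, (1 - Real.cos (2 * Real.pi * ph n A α β j - θ)) := by
  refine ⟨Complex.arg (fhat n A α β), ?_⟩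
  have h := fhat_rot n hn A α β (Complex.arg (fhat n A α β))
  rw [Finset.sum_sub_distrib, ← h]
  have h2 : fhat n A α β * Complex.exp (((-Complex.arg (fhat n A α β) : ℝ) : ℂ) * Complex.I)
      = ((‖fhat n A α β‖ : ℝ) : ℂ) := by
    nth_rewrite 1 [← Complex.norm_mul_exp_arg_mul_I (fhat n A α β)]
    rw [mul_assoc, ← Complex.exp_add]
    push_cast
    rw [show (Complex.arg (fhat n A α β) : ℂ) * Complex.I + -(Complex.arg (fhat n A α β) : ℂ) * Complex.I = 0 by ring]
    simp
  rw [h2, Complex.ofReal_re]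
  simp; ring

lemma fhat_le (n : ℕ) (hn : 1 ≤ n) (A : Fin n → ℕ) (α β θ : ℝ) :
    n * (1 - ‖fhat n A α β‖) ≤
      ∑ j ∈ Finset.Icc 1 n, (1 - Real.cos (2 * Real.pi * ph n A α β j - θ)) := by
  have h := fhat_rot n hn A α β θ
  rw [Finset.sum_sub_distrib, ← h]
  have h2 : (fhat n A α β * Complex.exp (((-θ : ℝ) : ℂ) * Complex.I)).re ≤ ‖fhat n A α β‖ := by
    refine (Complex.re_le_norm _).trans ?_
    rw [norm_mul, Complex.norm_exp_ofReal_mul_I, mul_one]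
  simp
  have : (0 : ℝ) ≤ n := Nat.cast_nonneg n
  simp at h2
  nlinarith

lemma cos_quasi (x y : ℝ) :
    1 - Real.cos (x + y) ≤ 2 * (1 - Real.cos x) + 2 * (1 - Real.cos y) := by
  rw [Real.cos_add]
  nlinarith [sq_nonneg (Real.cos x + Real.cos y - 2), sq_nonneg (Real.sin x - Real.sin y),
    Real.sin_sq_add_cos_sq x, Real.sin_sq_add_cos_sq y]

lemma cos_second (a b c : ℝ) : 1 - Real.cos (a - 2 * b + c) ≤
    4 * (1 - Real.cos a) + 8 * (1 - Real.cos b) + 4 * (1 - Real.cos c) := by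
  have h1 := cos_quasi (a + c) (-(b + b))
  have h2 := cos_quasi a c
  have h3 := cos_quasi b b
  rw [Real.cos_neg] at h1
  rw [show a - 2 * b + c = a + c + -(b + b) by ring]
  linarith

lemma abs_sin_mul_le (m : ℕ) (x : ℝ) : |Real.sin (m * x)| ≤ m * |Real.sin x| := by
  induction m with
  | zero => simp
  | succ m ih =>
    push_cast
    rw [add_mul, one_mul, Real.sin_add]
    refine (abs_add_le _ _).trans ?_
    rw [abs_mul, abs_mul, add_mul, one_mul]
    have h1 := Real.abs_cos_le_one x
    have h2 := Real.abs_cos_le_one (m * x)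
    have h3 := abs_nonneg (Real.sin (m * x))
    have h4 := abs_nonneg (Real.sin x)
    nlinarith

lemma cos_mul_le (m : ℕ) (x : ℝ) : 1 - Real.cos (m * x) ≤ m ^ 2 * (1 - Real.cos x) := by
  have h1 : ∀ y : ℝ, 1 - Real.cos y = 2 * Real.sin (y / 2) ^ 2 := by
    intro y
    have h := Real.cos_two_mul (y / 2)
    have h' := Real.sin_sq_add_cos_sq (y / 2)
    rw [show 2 * (y / 2) = y by ring] at h
    linarith
  rw [h1, h1, mul_div_assoc]
  have h2 := abs_sin_mul_le m (x / 2)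
  have h3 : Real.sin (m * (x / 2)) ^ 2 ≤ (m * |Real.sin (x / 2)|) ^ 2 := by
    rw [← sq_abs (Real.sin (m * (x / 2)))]
    exact pow_le_pow_left₀ (abs_nonneg _) h2 2
  rw [mul_pow, sq_abs] at h3
  linarith

lemma fhat_scale (n : ℕ) (hn : 1 ≤ n) (A : Fin n → ℕ) (α β : ℝ) (m : ℕ) :
    1 - ‖fhat n A (m * α) (m * β)‖ ≤ m ^ 2 * (1 - ‖fhat n A α β‖) := by
  obtain ⟨θ, hθ⟩ := fhat_exists n hn A α β
  have h := fhat_le n hn A (m * α) (m * β) (m * θ)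
  have hn0 : (0 : ℝ) < n := by exact_mod_cast hn
  refine le_of_mul_le_mul_left ?_ hn0
  refine h.trans ?_
  rw [show (n : ℝ) * (m ^ 2 * (1 - ‖fhat n A α β‖)) = m ^ 2 * (n * (1 - ‖fhat n A α β‖)) by ring, hθ,
    Finset.mul_sum]
  refine Finset.sum_le_sum fun j _ => ?_
  refine le_trans (le_of_eq ?_) (cos_mul_le m _)
  congr 2
  unfold ph; ring

lemma fhat_norm_le_one (n : ℕ) (hn : 1 ≤ n) (A : Fin n → ℕ) (α β : ℝ) : ‖fhat n A α β‖ ≤ 1 := by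
  obtain ⟨θ, hθ⟩ := fhat_exists n hn A α β
  have hn0 : (0 : ℝ) < n := by exact_mod_cast hn
  have : 0 ≤ n * (1 - ‖fhat n A α β‖) := by
    rw [hθ]; exact Finset.sum_nonneg fun j _ => by linarith [Real.cos_le_one (2 * Real.pi * ph n A α β j - θ)]
  have := nonneg_of_mul_nonneg_right this hn0
  linarith

lemma jj_inj (k r r' b b' : ℕ) (hr : r < k) (hr' : r' < k) (h : jj k r b = jj k r' b') :
    r = r' ∧ b = b' := by
  rcases lt_trichotomy b b' with hlt | heq | hgt
  · have := jj_sep k r _ _ hlt; unfold jj at *; omega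
  · subst heq; unfold jj at h; omega
  · have := jj_sep k r _ _ hgt; unfold jj at *; omega

lemma sum_shift (n k M t : ℕ) (ht : t ≤ 2 * k) (hM : 6 * k * M ≤ n) (D : ℕ → ℝ) (hD : ∀ j, 0 ≤ D j) :
    ∑ r ∈ Finset.range k, ∑ b : Fin M, D (jj k r b + t) ≤ ∑ j ∈ Finset.Icc 1 n, D j := by
  rw [← Finset.sum_product']
  have hinj : Set.InjOn (fun p : ℕ × Fin M => jj k p.1 p.2 + t)
      (Finset.range k ×ˢ (Finset.univ : Finset (Fin M)) : Finset (ℕ × Fin M)) := by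
    intro p hp q hq h
    simp at hp hq h
    obtain ⟨h1, h2⟩ := jj_inj k _ _ _ _ hp hq h
    exact Prod.ext h1 (Fin.ext h2)
  rw [← Finset.sum_image (f := D) hinj]
  refine Finset.sum_le_sum_of_subset_of_nonneg ?_ fun j _ _ => hD j
  intro j hj
  simp only [Finset.mem_image, Finset.mem_product, Finset.mem_range, Finset.mem_univ, and_true] at hj
  obtain ⟨p, hp, rfl⟩ := hj
  have := jj_bound n k M p.1 p.2 hp p.2.2 hM
  rw [Finset.mem_Icc]
  constructor
  · unfold jj; omega
  · omega

lemma good_det (n k M : ℕ) (hn : 1 ≤ n) (hM : 6 * k * M ≤ n) (hM2 : n ≤ 12 * k * M) (A : Fin n → ℕ)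
    (α : ℝ) (hgood : ∀ r < k, (M : ℝ) / 8 ≤ ∑ b : Fin M, YY A α k (jj k r b)) (β : ℝ) :
    1 / 1536 ≤ 1 - ‖fhat n A α β‖ := by
  obtain ⟨θ, hθ⟩ := fhat_exists n hn A α β
  set D : ℕ → ℝ := fun j => 1 - Real.cos (2 * Real.pi * ph n A α β j - θ) with hDdef
  have hD : ∀ j, 0 ≤ D j := fun j => by
    simp only [hDdef]; linarith [Real.cos_le_one (2 * Real.pi * ph n A α β j - θ)]
  have hY : ∀ j, YY A α k j ≤ 4 * D (j + 2 * k) + 8 * D (j + k) + 4 * D (j + 0) := by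
    intro j
    unfold YY
    refine le_trans (le_of_eq ?_) (cos_second _ _ _)
    rw [← gA_second]
    congr 2
    unfold ph
    push_cast; ring_nf
  have h1 : (k : ℝ) * (M / 8) ≤ ∑ r ∈ Finset.range k, ∑ b : Fin M, YY A α k (jj k r b) := by
    have := Finset.card_nsmul_le_sum (Finset.range k)
      (fun r => ∑ b : Fin M, YY A α k (jj k r b)) ((M : ℝ) / 8)
      (fun r hr => hgood r (Finset.mem_range.1 hr))
    simpa using this
  have h2 : ∑ r ∈ Finset.range k, ∑ b : Fin M, YY A α k (jj k r b) ≤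
      4 * ∑ r ∈ Finset.range k, ∑ b : Fin M, D (jj k r b + 2 * k) +
      8 * ∑ r ∈ Finset.range k, ∑ b : Fin M, D (jj k r b + k) +
      4 * ∑ r ∈ Finset.range k, ∑ b : Fin M, D (jj k r b + 0) := by
    simp only [Finset.mul_sum, ← Finset.sum_add_distrib]
    exact Finset.sum_le_sum fun r _ => Finset.sum_le_sum fun b _ => hY _
  have h3 := sum_shift n k M (2 * k) le_rfl hM D hD
  have h4 := sum_shift n k M k (by omega) hM D hD
  have h5 := sum_shift n k M 0 (by omega) hM D hD
  have h6 : (n : ℝ) ≤ 12 * k * M := by exact_mod_cast hM2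
  have hn0 : (0 : ℝ) < n := by exact_mod_cast hn
  refine le_of_mul_le_mul_left ?_ hn0
  rw [hθ]
  linarith

lemma main_large (n : ℕ) (hn : 3 ≤ n) (hlog : 1 ≤ Real.log n) (α : ℝ) (hα : |α| ≤ 1 / 2)
    (hbig : 1440 * Real.log n ≤ α ^ 2 * n) (G : Finset (Fin n → ℕ)) (hG : G ⊆ dieFinset n)
    (hsub : ∀ A ∈ dieFinset n, (∀ β, 1 / 1536 ≤ 1 - ‖fhat n A α β‖) → A ∈ G) :
    1 - (n : ℝ) ^ (-10 : ℤ) ≤ (G.card : ℝ) / (dieFinset n).card := by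
  have hn0 : (0 : ℝ) < n := by exact_mod_cast (by omega : 0 < n)
  have hn1 : (1 : ℝ) ≤ n := by exact_mod_cast (by omega : 1 ≤ n)
  have hα2 : 0 < α ^ 2 := by
    by_contra h
    have : α ^ 2 = 0 := le_antisymm (not_lt.1 h) (sq_nonneg _)
    rw [this] at hbig; linarith
  have hα4 : α ^ 2 ≤ 1 / 4 := by
    rw [← sq_abs]; nlinarith [abs_nonneg α]
  set k := ⌈1 / (4 * α ^ 2)⌉₊ with hk
  have hk1 : 1 / (4 * α ^ 2) ≤ k := Nat.le_ceil _
  have hk2 : (k : ℝ) < 1 / (4 * α ^ 2) + 1 := Nat.ceil_lt_add_one (by positivity)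
  have hk3 : 1 / 4 ≤ α ^ 2 * k := by
    have := mul_le_mul_of_nonneg_left hk1 hα2.le
    have h2 : α ^ 2 * (1 / (4 * α ^ 2)) = 1 / 4 := by
      have hα0 : α ≠ 0 := fun h => by simp [h] at hα2
      field_simp
    linarith
  have hk4 : α ^ 2 * k ≤ 1 / 2 := by
    have := mul_le_mul_of_nonneg_left hk2.le hα2.le
    have h2 : α ^ 2 * (1 / (4 * α ^ 2)) = 1 / 4 := by
      have hα0 : α ≠ 0 := fun h => by simp [h] at hα2
      field_simp
    nlinarith
  have hk0 : 0 < k := by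
    rcases Nat.eq_zero_or_pos k with h | h
    · rw [h] at hk3; norm_num at hk3
    · exact h
  have hk0' : (0 : ℝ) < k := by exact_mod_cast hk0
  set M := n / (6 * k) with hMdef
  have hM : 6 * k * M ≤ n := Nat.mul_div_le n (6 * k)
  have hMlt : n < 6 * k * (M + 1) := by
    have := Nat.lt_mul_div_succ n (show 0 < 6 * k by omega)
    simpa using this
  have hMlt' : (n : ℝ) < 6 * k * (M + 1) := by exact_mod_cast hMlt
  have hMlow : 240 * Real.log n ≤ M := by
    have h1 : α ^ 2 * n ≤ α ^ 2 * (6 * k * (M + 1)) := by gcongr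
    have h2 : α ^ 2 * (6 * k * (M + 1)) = 6 * (α ^ 2 * k) * (M + 1) := by ring
    have h3 : 6 * (α ^ 2 * k) * ((M : ℝ) + 1) ≤ 6 * (1 / 2) * (M + 1) := by gcongr
    linarith
  have hM1 : 1 ≤ M := by
    have : (0 : ℝ) < M := by linarith
    exact_mod_cast this
  have hM2 : n ≤ 12 * k * M := by
    have : 6 * k * 1 ≤ 6 * k * M := Nat.mul_le_mul_left _ hM1
    nlinarith
  have hkn : k ≤ n := by nlinarith
  have hkn' : (k : ℝ) ≤ n := by exact_mod_cast hkn
  set Ω := (Fintype.piFinset fun _ : Fin n => Finset.Icc 1 n) with hΩ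
  set Bd : ℕ → Finset (Fin n → ℕ) := fun r =>
    Ω.filter fun A => ∑ b : Fin M, YY A α k (jj k r b) < M / 8 with hBd
  have hcov : dieFinset n ⊆ G ∪ (Finset.range k).biUnion Bd := by
    intro A hA
    by_cases h : ∃ r < k, A ∈ Bd r
    · obtain ⟨r, hr, h⟩ := h
      exact Finset.mem_union_right _ (Finset.mem_biUnion.2 ⟨r, Finset.mem_range.2 hr, h⟩)
    · push Not at h
      refine Finset.mem_union_left _ (hsub A hA ?_)
      refine good_det n k M (by omega) hM hM2 A α ?_
      intro r hr
      by_contra hc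
      exact h r hr (Finset.mem_filter.2 ⟨(Finset.mem_filter.1 hA).1, not_le.1 hc⟩)
  have hcard : ((dieFinset n).card : ℝ) ≤ G.card + ∑ r ∈ Finset.range k, ((Bd r).card : ℝ) := by
    have h1 := (Finset.card_le_card hcov).trans (Finset.card_union_le _ _)
    have h2 : ((Finset.range k).biUnion Bd).card ≤ ∑ r ∈ Finset.range k, (Bd r).card :=
      Finset.card_biUnion_le
    exact_mod_cast h1.trans (Nat.add_le_add_left h2 _)
  have hexp : Real.exp (-((M : ℝ) / 16)) ≤ ((n : ℝ) ^ 15)⁻¹ := by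
    have : ((n : ℝ) ^ 15)⁻¹ = Real.exp (-(15 * Real.log n)) := by
      rw [Real.exp_neg, show (15 : ℝ) * Real.log n = ((15 : ℕ) : ℝ) * Real.log n by norm_num,
        Real.exp_nat_mul, Real.exp_log hn0]
    rw [this]
    apply Real.exp_le_exp.2
    linarith
  have hbad : ∑ r ∈ Finset.range k, ((Bd r).card : ℝ) ≤ n * ((n : ℝ) ^ n * ((n : ℝ) ^ 15)⁻¹) := by
    calc ∑ r ∈ Finset.range k, ((Bd r).card : ℝ)
        ≤ ∑ r ∈ Finset.range k, (n : ℝ) ^ n * ((n : ℝ) ^ 15)⁻¹ := by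
          refine Finset.sum_le_sum fun r hr => ?_
          refine (bad_count n k M r (Finset.mem_range.1 hr) hM (by omega) α hα hk3).trans ?_
          gcongr
      _ = k * ((n : ℝ) ^ n * ((n : ℝ) ^ 15)⁻¹) := by simp
      _ ≤ _ := by gcongr
  have hD : (n : ℝ) ^ n ≤ (dieFinset n).card * (n : ℝ) ^ 3 := by exact_mod_cast die_card n (by omega)
  have hDpos : (0 : ℝ) < (dieFinset n).card := by
    by_contra h
    have h0 : ((dieFinset n).card : ℝ) = 0 := le_antisymm (not_lt.1 h) (Nat.cast_nonneg _)
    rw [h0, zero_mul] at hD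
    exact absurd hD (not_le.2 (by positivity))
  rw [le_div_iff₀ hDpos]
  have h10 : (n : ℝ) ^ (-10 : ℤ) = ((n : ℝ) ^ 10)⁻¹ := by
    rw [zpow_neg]; norm_cast
  rw [h10]
  have hfin : (n : ℝ) * ((n : ℝ) ^ n * ((n : ℝ) ^ 15)⁻¹) ≤ ((n : ℝ) ^ 10)⁻¹ * (dieFinset n).card := by
    calc (n : ℝ) * ((n : ℝ) ^ n * ((n : ℝ) ^ 15)⁻¹)
        ≤ n * (((dieFinset n).card * (n : ℝ) ^ 3) * ((n : ℝ) ^ 15)⁻¹) := by gcongr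
      _ = ((n : ℝ) ^ 10)⁻¹ * (dieFinset n).card * (n : ℝ)⁻¹ := by field_simp
      _ ≤ ((n : ℝ) ^ 10)⁻¹ * (dieFinset n).card * 1 := by
          gcongr; exact inv_le_one_of_one_le₀ hn1
      _ = _ := by ring
  linarith

lemma log_small : ∃ N : ℕ, 3 ≤ N ∧ ∀ n : ℕ, N ≤ n → 1 ≤ Real.log n ∧ 23040 * Real.log n ≤ n := by
  have h1 := (Real.isLittleO_log_id_atTop.bound (show (0 : ℝ) < 1 / 23040 by norm_num))
  have h2 := tendsto_natCast_atTop_atTop (R := ℝ) |>.eventually h1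
  have h3 := (Real.tendsto_log_atTop.comp (tendsto_natCast_atTop_atTop (R := ℝ))).eventually_ge_atTop 1
  obtain ⟨N, hN⟩ := Filter.eventually_atTop.1 (h2.and h3)
  refine ⟨max N 3, le_max_right _ _, fun n hn => ?_⟩
  obtain ⟨h4, h5⟩ := hN n (le_trans (le_max_left _ _) hn)
  simp only [Function.comp] at h5
  refine ⟨h5, ?_⟩
  simp only [id, Real.norm_eq_abs] at h4
  rw [abs_of_nonneg (by linarith), abs_of_nonneg (Nat.cast_nonneg n)] at h4
  linarith

open scoped Classical

/-- for all large enough n and every α with |α| ≤ 1/2, with probability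
at least 1 − n^{−10} over a uniformly random n-sided die A, for every β we have
|f̂(α,β)| ≤ 1 − δ with δ = min(10^{−13}, 10^{−11}·α²·n/log n). -/
theorem charFun_bounded_away_from_one :
    ∃ N : ℕ, ∀ n : ℕ, N ≤ n → ∀ α : ℝ, |α| ≤ 1 / 2 →
      1 - (n : ℝ) ^ (-10 : ℤ) ≤
        (((dieFinset n).filter fun A => ∀ β : ℝ,
            ‖fhat n A α β‖ ≤
              1 - min ((10 : ℝ) ^ (-13 : ℤ))
                ((10 : ℝ) ^ (-11 : ℤ) * α ^ 2 * n / Real.log n)).card : ℝ) /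
          (dieFinset n).card := by
  obtain ⟨N, hN3, hN⟩ := log_small
  refine ⟨N, fun n hn α hα => ?_⟩
  obtain ⟨hlog, hlog2⟩ := hN n hn
  have hn3 : 3 ≤ n := hN3.trans hn
  have hn0 : (0 : ℝ) < n := by exact_mod_cast (by omega : 0 < n)
  set G := (dieFinset n).filter fun A => ∀ β : ℝ,
            ‖fhat n A α β‖ ≤
              1 - min ((10 : ℝ) ^ (-13 : ℤ))
                ((10 : ℝ) ^ (-11 : ℤ) * α ^ 2 * n / Real.log n) with hGdef
  have hG : G ⊆ dieFinset n := Finset.filter_subset _ _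
  by_cases hbig : 1440 * Real.log n ≤ α ^ 2 * n
  · refine main_large n hn3 hlog α hα hbig G hG ?_
    intro A hA h
    refine Finset.mem_filter.2 ⟨hA, fun β => ?_⟩
    have h1 := h β
    have h2 := min_le_left ((10 : ℝ) ^ (-13 : ℤ)) ((10 : ℝ) ^ (-11 : ℤ) * α ^ 2 * n / Real.log n)
    have h3 : (10 : ℝ) ^ (-13 : ℤ) ≤ 1 / 1536 := by norm_num
    linarith
  push Not at hbig
  -- an auxiliary integer multiple `m * α` in the good range
  have hs0 : 0 < 1440 * Real.log n / n := by positivity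
  set s := Real.sqrt (1440 * Real.log n / n) with hs
  have hssq : s ^ 2 = 1440 * Real.log n / n := Real.sq_sqrt hs0.le
  have hspos : 0 < s := Real.sqrt_pos.2 hs0
  have hs4 : s ≤ 1 / 4 := by
    have : s ^ 2 ≤ (1 / 4) ^ 2 := by
      rw [hssq, div_le_iff₀ hn0]; linarith
    exact le_of_sq_le_sq this (by norm_num)
  rcases eq_or_ne α 0 with rfl | hα0
  · -- here the bound is trivial; apply `main_large` with `1 / 2`
    refine main_large n hn3 hlog (1 / 2) (by norm_num [abs_of_pos]) (by linarith) G hG ?_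
    intro A hA _
    refine Finset.mem_filter.2 ⟨hA, fun β => ?_⟩
    have h1 := fhat_norm_le_one n (by omega) A 0 β
    have h2 := min_le_right ((10 : ℝ) ^ (-13 : ℤ)) ((10 : ℝ) ^ (-11 : ℤ) * (0 : ℝ) ^ 2 * n / Real.log n)
    have h3 : (10 : ℝ) ^ (-11 : ℤ) * (0 : ℝ) ^ 2 * n / Real.log n = 0 := by simp
    linarith
  have hapos : 0 < |α| := abs_pos.2 hα0
  have has : |α| ≤ s := by
    refine le_of_sq_le_sq ?_ hspos.le
    rw [hssq, sq_abs, le_div_iff₀ hn0]; linarith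
  set m := ⌈s / |α|⌉₊ with hm
  have hm1 : s / |α| ≤ m := Nat.le_ceil _
  have hm2 : (m : ℝ) < s / |α| + 1 := Nat.ceil_lt_add_one (by positivity)
  have hm3 : s ≤ m * |α| := by rwa [div_le_iff₀ hapos] at hm1
  have hm4 : m * |α| ≤ 2 * s := by
    have := mul_le_mul_of_nonneg_right hm2.le hapos.le
    rw [add_mul, div_mul_cancel₀ _ hapos.ne'] at this
    linarith
  have hm0 : (0 : ℝ) < m := lt_of_lt_of_le (by positivity) hm1
  have habs : |m * α| = m * |α| := by rw [abs_mul, abs_of_pos hm0]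
  have hlow : s ^ 2 ≤ (m * α) ^ 2 := by
    rw [← sq_abs (m * α), habs]; exact pow_le_pow_left₀ hspos.le hm3 2
  have hupp : (m : ℝ) ^ 2 * α ^ 2 ≤ 4 * s ^ 2 := by
    rw [← mul_pow, ← sq_abs (m * α), habs]
    calc (m * |α|) ^ 2 ≤ (2 * s) ^ 2 := pow_le_pow_left₀ (by positivity) hm4 2
      _ = _ := by ring
  refine main_large n hn3 hlog (m * α) (by rw [habs]; linarith) ?_ G hG ?_
  · rw [hssq, div_le_iff₀ hn0] at hlow; exact hlow
  intro A hA h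
  refine Finset.mem_filter.2 ⟨hA, fun β => ?_⟩
  have h1 := (h (m * β)).trans (fhat_scale n (by omega) A α β m)
  have h2 := min_le_right ((10 : ℝ) ^ (-13 : ℤ)) ((10 : ℝ) ^ (-11 : ℤ) * α ^ 2 * n / Real.log n)
  have h3 : (10 : ℝ) ^ (-11 : ℤ) * α ^ 2 * n / Real.log n ≤ 1 - ‖fhat n A α β‖ := by
    refine le_of_mul_le_mul_left (le_trans ?_ h1) (by positivity : (0 : ℝ) < m ^ 2)
    have hl : 0 < Real.log n := by linarith
    calc (m : ℝ) ^ 2 * ((10 : ℝ) ^ (-11 : ℤ) * α ^ 2 * n / Real.log n)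
        = (m ^ 2 * α ^ 2) * ((10 : ℝ) ^ (-11 : ℤ) * n / Real.log n) := by ring
      _ ≤ (4 * s ^ 2) * ((10 : ℝ) ^ (-11 : ℤ) * n / Real.log n) := by gcongr
      _ = 5760 * (10 : ℝ) ^ (-11 : ℤ) := by rw [hssq]; field_simp; norm_num
      _ ≤ _ := by norm_num
  linarith
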